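/- In the triangle group Δ(2, 3, 5), the pair (s₂s₁s₂⁻¹, ((s₁s₂)²s₁)·s₃²·((s₁s₂)²s₁)⁻¹) is Nielsen equivalent to the pair (s₃², s₁s₃²s₁⁻¹). -/

import Mathlib

/-- Relators of the triangle group Δ(p₁,p₂,p₃) on generators s₁,s₂,s₃. -/
def triangleRels (p₁ p₂ p₃ : ℕ) : Set (FreeGroup (Fin 3)) :=
  {FreeGroup.of 0 ^ p₁, FreeGroup.of 1 ^ p₂, FreeGroup.of 2 ^ p₃,
    FreeGroup.of 0 * FreeGroup.of 1 * FreeGroup.of 2}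

/-- The triangle group Δ(p₁,p₂,p₃). -/
abbrev Triangle (p₁ p₂ p₃ : ℕ) := PresentedGroup (triangleRels p₁ p₂ p₃)

/-- The images s₁, s₂, s₃ of the generators in the triangle group
(indexed by `0, 1, 2 : Fin 3`). -/
def triS (p₁ p₂ p₃ : ℕ) (i : Fin 3) : Triangle p₁ p₂ p₃ := PresentedGroup.of i

/-- An elementary Nielsen transformation on pairs of elements of a group. -/
inductive NielsenStep {G : Type*} [Group G] : G × G → G × G → Prop
  | inv₁ (g h : G) : NielsenStep (g, h) (g⁻¹, h)
  | inv₂ (g h : G) : NielsenStep (g, h) (g, h⁻¹)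
  | swap (g h : G) : NielsenStep (g, h) (h, g)
  | mul₁ (g h : G) : NielsenStep (g, h) (g * h, h)
  | mul₂ (g h : G) : NielsenStep (g, h) (g, h * g)

/-- Nielsen equivalence of pairs: the equivalence closure of elementary
Nielsen transformations. -/
def NielsenEquiv {G : Type*} [Group G] : G × G → G × G → Prop :=
  Relation.EqvGen NielsenStep

/-- If `a² = (ab)⁵ = 1`, then `ababa = b⁻¹ab⁻¹ab⁻¹`. -/
lemma ababa_eq_of_sq_of_pow_five {G : Type*} [Group G] {a b : G} (ha : a * a = 1)
    (hab : (a * b) ^ 5 = 1) :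
    a * b * a * b * a = b⁻¹ * a * b⁻¹ * a * b⁻¹ := by
  have ha' : a⁻¹ = a := inv_eq_of_mul_eq_one_left ha
  have h : a * b * a * b * a * (b⁻¹ * a * b⁻¹ * a * b⁻¹)⁻¹ = 1 := by
    simpa only [pow_succ, pow_zero, one_mul, mul_inv_rev, inv_inv, ha', mul_assoc] using hab
  exact mul_inv_eq_one.mp h

/-- In a group with `a² = b³ = (ab)⁵ = 1`, put `c = (ab)⁻¹` and `k = (ab)²a`.
Then `(bab⁻¹, kc²k⁻¹)` is Nielsen equivalent to `(c², ac²a⁻¹)`. -/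
lemma nielsenEquiv_of_relations {G : Type*} [Group G] {a b : G} (ha : a * a = 1)
    (hb : b ^ 3 = 1) (hab : (a * b) ^ 5 = 1) :
    NielsenEquiv
      (b * a * b⁻¹,
        ((a * b) ^ 2 * a) * ((a * b)⁻¹) ^ 2 * ((a * b) ^ 2 * a)⁻¹)
      (((a * b)⁻¹) ^ 2, a * ((a * b)⁻¹) ^ 2 * a⁻¹) := by
  have ha' : a⁻¹ = a := inv_eq_of_mul_eq_one_left ha
  have key := ababa_eq_of_sq_of_pow_five ha hab
  have hbb : b⁻¹ * b⁻¹ = b := by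
    rw [← mul_inv_rev, inv_eq_iff_mul_eq_one, ← hb, pow_succ, sq]
  have haa (x : G) : a * (a * x) = x := by rw [← mul_assoc, ha, one_mul]
  have hbb' (x : G) : b⁻¹ * (b⁻¹ * x) = b * x := by rw [← mul_assoc, hbb]
  have key' (x : G) :
      a * (b * (a * (b * (a * x)))) = b⁻¹ * (a * (b⁻¹ * (a * (b⁻¹ * x)))) := by
    simpa only [mul_assoc] using congrArg (· * x) key
  set g := b * a * b⁻¹ with hg
  set h := ((a * b) ^ 2 * a) * ((a * b)⁻¹) ^ 2 * ((a * b) ^ 2 * a)⁻¹ with hh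
  have step₁ : h * g = b * a * b⁻¹ * a * b * a * b := by
    rw [hh, hg]
    simp only [pow_succ, pow_zero, one_mul, mul_inv_rev, ha', mul_assoc, haa, key', hbb, hbb']
  have step₂ : g * (h * g) = a * b * a * b := by
    rw [step₁, hg]
    simp only [mul_assoc, haa, inv_mul_cancel_left, mul_inv_cancel_left]
  have step₃ : h * g * (g * (h * g)) = b * a * b * a := by
    rw [step₂, step₁]
    simp only [mul_assoc, haa, key', hbb', inv_mul_cancel, mul_one,
      mul_inv_cancel_left]
  have final : (((a * b)⁻¹) ^ 2, a * ((a * b)⁻¹) ^ 2 * a⁻¹) =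
      ((g * (h * g))⁻¹, (h * g * (g * (h * g)))⁻¹) := by
    rw [step₃, step₂]
    simp only [pow_succ, pow_zero, one_mul, mul_inv_rev, ha', mul_assoc, ha, mul_one]
  rw [final]
  exact .trans _ _ _ (.rel _ _ (.mul₂ g h)) <|
    .trans _ _ _ (.rel _ _ (.mul₁ _ _)) <|
    .trans _ _ _ (.rel _ _ (.mul₂ _ _)) <|
    .trans _ _ _ (.rel _ _ (.inv₁ _ _)) (.rel _ _ (.inv₂ _ _))

theorem stmt_13 (S : Fin 3 → Triangle 2 3 5) (hS : S = triS 2 3 5) :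
    NielsenEquiv
      (S 1 * S 0 * (S 1)⁻¹,
        ((S 0 * S 1) ^ 2 * S 0) * S 2 ^ 2 * ((S 0 * S 1) ^ 2 * S 0)⁻¹)
      (S 2 ^ 2, S 0 * S 2 ^ 2 * (S 0)⁻¹) := by
  have relation {r : FreeGroup (Fin 3)} (hr : r ∈ triangleRels 2 3 5) :
      PresentedGroup.mk (triangleRels 2 3 5) r = 1 := PresentedGroup.one_of_mem hr
  have h₀ : S 0 ^ 2 = 1 := by
    subst hS; exact relation (r := FreeGroup.of 0 ^ 2) (by simp [triangleRels])
  have h₁ : S 1 ^ 3 = 1 := by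
    subst hS; exact relation (r := FreeGroup.of 1 ^ 3) (by simp [triangleRels])
  have h₂ : S 2 ^ 5 = 1 := by
    subst hS; exact relation (r := FreeGroup.of 2 ^ 5) (by simp [triangleRels])
  have h₃ : S 0 * S 1 * S 2 = 1 := by
    subst hS
    exact relation (r := FreeGroup.of 0 * FreeGroup.of 1 * FreeGroup.of 2)
      (by simp [triangleRels])
  have hS₂ : S 2 = (S 0 * S 1)⁻¹ := eq_inv_of_mul_eq_one_right h₃
  rw [hS₂, inv_pow, inv_eq_one] at h₂
  rw [hS₂]
  exact nielsenEquiv_of_relations (by rw [← sq, h₀]) h₁ h₂
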